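/- Let Θ ⊆ I, let w₁ ∈ W^Θ, w₂ ∈ ^{Θ∪Θ^⊥}W, and i ∈ I. For a ∼_Θ-class c, let l₋₋(c) := −ℓ(a) + ℓ(b), where (a,b) is the unique representative of c with a ∈ W^{Θ∪Θ^⊥}, b ∈ ^ΘW. Write c for the class of (w₁, w₂), c' for the class of (σ_i w₁, w₂), and r := w₁⁻¹σ_i w₁. Then: (a) if either (ℓ(σ_i w₁) = ℓ(w₁) − 1 and r ∉ W_{Θ∪Θ^⊥}) or (ℓ(σ_i w₁) = ℓ(w₁) + 1 and r ∈ W_{Θ^⊥}), then l₋₋(c') = l₋₋(c) + 1; (b) if r ∈ W_Θ, then l₋₋(c') = l₋₋(c); (c) if either (ℓ(σ_i w₁) = ℓ(w₁) + 1 and r ∉ W_{Θ∪Θ^⊥}) or (ℓ(σ_i w₁) = ℓ(w₁) − 1 and r ∈ W_{Θ^⊥}), then l₋₋(c') = l₋₋(c) − 1. Moreover l₋₋(c') = l₋₋(c) if and only if c' = c. -/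

import Mathlib

open Classical

namespace Paper

variable {B : Type*} {M : CoxeterMatrix B} {W : Type*} [Group W]

/-- `Θ^⊥`: the indices whose simple reflections commute with all simple
reflections indexed by `Θ` (i.e. `m(i,j) = 2` for all `j ∈ Θ`). -/
def perp (M : CoxeterMatrix B) (Θ : Set B) : Set B := {i | i ∉ Θ ∧ ∀ j ∈ Θ, M i j = 2}

variable (cs : CoxeterSystem M W)

/-- The standard parabolic subgroup `W_J` generated by the simple reflections indexed by `J`. -/
def parabolic (J : Set B) : Subgroup W := Subgroup.closure (cs.simple '' J)

/-- `W^J`: the minimal-length representatives of the cosets `W/W_J`,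
`{w : ℓ(wu) = ℓ(w) + ℓ(u) for all u ∈ W_J}`. -/
def minRight (J : Set B) : Set W :=
  {w | ∀ u ∈ parabolic cs J, cs.length (w * u) = cs.length w + cs.length u}

/-- `^JW`: the minimal-length representatives of the cosets `W_J\W`,
`{w : ℓ(uw) = ℓ(u) + ℓ(w) for all u ∈ W_J}`. -/
def minLeft (J : Set B) : Set W :=
  {w | ∀ u ∈ parabolic cs J, cs.length (u * w) = cs.length u + cs.length w}

/-- The Bruhat order on `W`: `x ≤ y` iff `y` is obtained from `x` by a chain of
right multiplications by reflections, each strictly increasing the length. -/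
def bruhatLE : W → W → Prop :=
  Relation.ReflTransGen (fun x y => ∃ t, cs.IsReflection t ∧ y = x * t ∧ cs.length x < cs.length y)

/-- The equivalence relation `∼_Θ` on `W × W`:
`(x,y) ∼_Θ (x',y')` iff there are `u ∈ W_{Θ∪Θ^⊥}` and `v ∈ W_Θ` with `x' = xu`, `y' = u⁻¹vy`. -/
def simRel (Θ : Set B) (p q : W × W) : Prop :=
  ∃ u ∈ parabolic cs (Θ ∪ perp M Θ), ∃ v ∈ parabolic cs Θ,
    q.1 = p.1 * u ∧ q.2 = u⁻¹ * v * p.2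

/-- `w^J`: the minimal-length element of the coset `w W_J`. -/
noncomputable def projR (J : Set B) (w : W) : W :=
  if h : ∃ a, a ∈ minRight cs J ∧ a⁻¹ * w ∈ parabolic cs J then h.choose else w

/-- `^Jw`: the minimal-length element of the coset `W_J w`. -/
noncomputable def projL (J : Set B) (w : W) : W :=
  if h : ∃ a, a ∈ minLeft cs J ∧ w * a⁻¹ ∈ parabolic cs J then h.choose else w

theorem end_mul_apply {α : Type*} (f g : Function.End α) (x : α) : (f * g) x = f (g x) := rfl

/-- The action of a simple reflection on `W × ZMod 2`: it conjugates the first component and flips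
the sign of `s i`. -/
noncomputable def signedConj (i : B) : Function.End (W × ZMod 2) := fun p =>
  (cs.simple i * p.1 * cs.simple i, p.2 + if p.1 = cs.simple i then 1 else 0)

theorem signedConj_mul_pow_apply (i j : B) (n : ℕ) (t : W) (z : ZMod 2) :
    ((signedConj cs i * signedConj cs j) ^ n) (t, z) =
      ((cs.simple i * cs.simple j) ^ n * t * ((cs.simple i * cs.simple j) ^ n)⁻¹,
        z + ∑ k ∈ Finset.range (2 * n),
          if t = cs.simple j * (cs.simple i * cs.simple j) ^ k then 1 else 0) := by
  induction n with
  | zero => simp; rfl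
  | succ n ih =>
    have hflip : ((cs.simple i * cs.simple j) ^ n)⁻¹ * cs.simple j =
        cs.simple j * (cs.simple i * cs.simple j) ^ n := by
      have := SemiconjBy.pow_right (show SemiconjBy (cs.simple j) (cs.simple i * cs.simple j)
        (cs.simple i * cs.simple j)⁻¹ by simp [SemiconjBy, mul_assoc]) n
      rw [inv_pow] at this
      exact this.symm
    have h₁ : (cs.simple i * cs.simple j) ^ n * t * ((cs.simple i * cs.simple j) ^ n)⁻¹ =
        cs.simple j ↔ t = cs.simple j * (cs.simple i * cs.simple j) ^ (2 * n) := by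
      rw [mul_inv_eq_iff_eq_mul, ← eq_inv_mul_iff_mul_eq, ← mul_assoc, hflip, two_mul, pow_add,
        ← mul_assoc]
    have h₂ : cs.simple j * ((cs.simple i * cs.simple j) ^ n * t *
        ((cs.simple i * cs.simple j) ^ n)⁻¹) * cs.simple j =
        cs.simple i ↔ t = cs.simple j * (cs.simple i * cs.simple j) ^ (2 * n + 1) := by
      rw [← eq_mul_inv_iff_mul_eq, cs.inv_simple, ← eq_inv_mul_iff_mul_eq, cs.inv_simple,
        mul_inv_eq_iff_eq_mul, ← eq_inv_mul_iff_mul_eq, ← mul_assoc, ← mul_assoc, hflip,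
        show 2 * n + 1 = n + (1 + n) by ring, pow_add, pow_add, pow_one]
      simp only [mul_assoc]
    rw [pow_succ', end_mul_apply, ih, end_mul_apply]
    simp only [signedConj, h₁, h₂, Prod.mk.injEq]
    constructor
    · simp [pow_succ', mul_assoc]
    · rw [show 2 * (n + 1) = 2 * n + 1 + 1 by ring, Finset.sum_range_succ, Finset.sum_range_succ]
      simp only [add_assoc]

theorem signedConj_isLiftable : M.IsLiftable (signedConj cs) := by
  intro i j
  funext ⟨t, z⟩
  rw [signedConj_mul_pow_apply, two_mul, Finset.sum_range_add]
  simp [pow_add, CharTwo.add_self_eq_zero]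
  rfl

/-- The action of `W` on `W × ZMod 2` extending `signedConj`. -/
noncomputable def signedConjHom : W →* Function.End (W × ZMod 2) :=
  cs.lift ⟨signedConj cs, signedConj_isLiftable cs⟩

theorem signedConjHom_simple (i : B) : signedConjHom cs (cs.simple i) = signedConj cs i :=
  cs.lift_apply_simple _ _

theorem signedConjHom_wordProd (ω : List B) (t : W) (z : ZMod 2) :
    signedConjHom cs (cs.wordProd ω) (t, z) =
      (cs.wordProd ω * t * (cs.wordProd ω)⁻¹, z + (cs.rightInvSeq ω).count t) := by
  induction ω with
  | nil => simp; rfl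
  | cons i ω ih =>
    rw [cs.wordProd_cons, map_mul, end_mul_apply, ih,
      signedConjHom_simple]
    simp only [signedConj, CoxeterSystem.rightInvSeq, List.count_cons, Prod.mk.injEq]
    constructor
    · simp [mul_assoc]
    · push_cast
      rw [add_assoc]
      have : (cs.wordProd ω)⁻¹ * cs.simple i * cs.wordProd ω = t ↔
          cs.wordProd ω * t * (cs.wordProd ω)⁻¹ = cs.simple i := by
        rw [mul_inv_eq_iff_eq_mul, mul_assoc, inv_mul_eq_iff_eq_mul, eq_comm]
      simp [this]

theorem mem_rightInvSeq_of_isRightDescent {ω : List B} {i : B}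
    (h : cs.IsRightDescent (cs.wordProd ω) i) : cs.simple i ∈ cs.rightInvSeq ω := by
  by_contra hmem
  obtain ⟨ω', hω', hprod⟩ := cs.exists_isReduced (cs.wordProd ω * cs.simple i)
  have key := signedConjHom_wordProd cs ω' (cs.simple i) 0
  rw [← hprod, map_mul, end_mul_apply, signedConjHom_simple] at key
  have hs : signedConj cs i (cs.simple i, 0) = (cs.simple i, 1) := by simp [signedConj]
  rw [hs, signedConjHom_wordProd, List.count_eq_zero.mpr hmem] at key
  have hmem' : cs.simple i ∈ cs.rightInvSeq ω' := by
    by_contra h'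
    rw [List.count_eq_zero.mpr h'] at key
    simp at key
  have := (cs.isRightInversion_of_mem_rightInvSeq hω' hmem').2
  rw [← hprod, cs.simple_mul_simple_cancel_right] at this
  exact lt_asymm this h

/-- The exchange condition. -/
theorem exists_mul_simple_eq_eraseIdx {ω : List B} {i : B}
    (h : cs.IsRightDescent (cs.wordProd ω) i) :
    ∃ k < ω.length, cs.wordProd ω * cs.simple i = cs.wordProd (ω.eraseIdx k) := by
  obtain ⟨k, hk, hk'⟩ := List.mem_iff_getElem.mp (mem_rightInvSeq_of_isRightDescent cs h)
  refine ⟨k, by simpa using hk, ?_⟩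
  rw [← cs.wordProd_mul_getD_rightInvSeq, List.getD_eq_getElem _ 1 hk, hk']

theorem simple_mem_parabolic {J : Set B} {i : B} (hi : i ∈ J) :
    cs.simple i ∈ parabolic cs J := Subgroup.subset_closure ⟨i, hi, rfl⟩

theorem parabolic_mono {J K : Set B} (h : J ⊆ K) : parabolic cs J ≤ parabolic cs K :=
  Subgroup.closure_mono (Set.image_mono h)

theorem wordProd_mem_parabolic {J : Set B} {ω : List B} (h : ∀ i ∈ ω, i ∈ J) :
    cs.wordProd ω ∈ parabolic cs J := by
  induction ω with
  | nil => simp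
  | cons i ω ih =>
    rw [cs.wordProd_cons]
    exact mul_mem (simple_mem_parabolic cs (h i (by simp)))
      (ih fun k hk => h k (List.mem_cons_of_mem _ hk))

theorem exists_isReduced_of_mem_parabolic {J : Set B} {w : W} (hw : w ∈ parabolic cs J) :
    ∃ ω : List B, cs.IsReduced ω ∧ w = cs.wordProd ω ∧ ∀ i ∈ ω, i ∈ J := by
  have step (w : W) (i : B) (hi : i ∈ J)
      (ih : ∃ ω : List B, cs.IsReduced ω ∧ w = cs.wordProd ω ∧ ∀ i ∈ ω, i ∈ J) :
      ∃ ω : List B, cs.IsReduced ω ∧ w * cs.simple i = cs.wordProd ω ∧ ∀ i ∈ ω, i ∈ J := by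
    obtain ⟨ω, hω, rfl, hJ⟩ := ih
    by_cases hd : cs.IsRightDescent (cs.wordProd ω) i
    · obtain ⟨k, hk, hk'⟩ := exists_mul_simple_eq_eraseIdx cs hd
      refine ⟨ω.eraseIdx k, ?_, hk', fun j hj => hJ j (List.mem_of_mem_eraseIdx hj)⟩
      rw [cs.isRightDescent_iff, hk', hω.eq] at hd
      have := List.length_eraseIdx_add_one hk
      unfold CoxeterSystem.IsReduced
      omega
    · refine ⟨ω.concat i, ?_, (cs.wordProd_concat i ω).symm, fun j hj => ?_⟩
      · rw [cs.not_isRightDescent_iff, hω.eq] at hd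
        rw [CoxeterSystem.IsReduced, cs.wordProd_concat, hd, List.length_concat]
      · rw [List.concat_eq_append, List.mem_append, List.mem_singleton] at hj
        rcases hj with hj | rfl
        exacts [hJ j hj, hi]
  unfold parabolic at hw
  induction hw using Subgroup.closure_induction_right with
  | one => exact ⟨[], by simp [CoxeterSystem.IsReduced], by simp, by simp⟩
  | mul_right x hx y hy ih =>
    obtain ⟨i, hi, rfl⟩ := hy
    exact step _ i hi ih
  | mul_inv_cancel x hx y hy ih =>
    obtain ⟨i, hi, rfl⟩ := hy
    rw [cs.inv_simple]
    exact step _ i hi ih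

/-- The folding condition. -/
theorem simple_mul_eq_mul_simple {w : W} {i j : B}
    (hi : cs.length (cs.simple i * w) = cs.length w + 1)
    (hj : cs.length (w * cs.simple j) = cs.length w + 1)
    (hij : cs.length (cs.simple i * w * cs.simple j) = cs.length w) :
    cs.simple i * w = w * cs.simple j := by
  obtain ⟨ω, hω, rfl⟩ := cs.exists_isReduced w
  have hd : cs.IsRightDescent (cs.wordProd (i :: ω)) j := by
    rw [CoxeterSystem.IsRightDescent, cs.wordProd_cons]
    omega
  obtain ⟨k, hk, hk'⟩ := exists_mul_simple_eq_eraseIdx cs hd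
  rw [cs.wordProd_cons] at hk'
  cases k with
  | zero =>
    rw [List.eraseIdx_cons_zero] at hk'
    nth_rw 2 [← hk']
    rw [cs.simple_mul_simple_cancel_right]
  | succ k =>
    rw [List.eraseIdx_cons_succ, cs.wordProd_cons, mul_assoc, mul_right_inj] at hk'
    have h₁ := cs.length_wordProd_le (ω.eraseIdx k)
    have h₂ := List.length_eraseIdx_add_one (l := ω) (i := k) (by simpa using hk)
    rw [← hk', hj, hω.eq] at h₁
    omega

/-! ### The geometric representation -/

/-- The linear form `v ↦ 2 B(α i, v)` of the geometric representation. -/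
noncomputable def corootForm (M : CoxeterMatrix B) (i : B) : Module.Dual ℝ (B →₀ ℝ) :=
  Finsupp.linearCombination ℝ fun j => -2 * Real.cos (Real.pi / M i j)

theorem corootForm_single (i j : B) :
    corootForm M i (Finsupp.single j 1) = -2 * Real.cos (Real.pi / M i j) := by
  simp [corootForm]

theorem corootForm_self (i : B) : corootForm M i (Finsupp.single i 1) = 2 := by
  simp [corootForm_single]

/-- The action of a simple reflection in the geometric representation. -/
noncomputable def geomReflection (M : CoxeterMatrix B) (i : B) : (B →₀ ℝ) ≃ₗ[ℝ] (B →₀ ℝ) :=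
  Module.reflection (corootForm_self (M := M) i)

theorem geomReflection_isLiftable : M.IsLiftable (geomReflection M) := by
  intro i j
  rcases eq_or_ne i j with rfl | hij
  · rw [M.diagonal, pow_one, geomReflection, mul_eq_one_iff_eq_inv, Module.reflection_inv]
  have h₁ : M i j ≠ 1 := M.off_diagonal i j hij
  ext1 z
  rw [geomReflection, geomReflection, Module.reflection_mul_reflection_pow_apply _ _ _ _
    (2 * Real.cos (2 * (Real.pi / M i j)))
    (by rw [corootForm_single, corootForm_single, M.symmetric j i, Real.cos_two_mul]; ring)]
  rcases eq_or_ne (M i j) 0 with h₀ | h₀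
  · simp [h₀]
  rcases eq_or_ne (M i j) 2 with h₂ | h₂
  · simp [h₂, corootForm_single, M.symmetric j i, mul_div_cancel₀]
    module
  set θ := 2 * (Real.pi / M i j) with hθ
  have hm : (3 : ℝ) ≤ M i j := by exact_mod_cast (show 3 ≤ M i j by omega)
  have hsin : Real.sin θ ≠ 0 := by
    refine (Real.sin_pos_of_pos_of_lt_pi (by positivity) ?_).ne'
    rw [hθ, ← mul_div_assoc, div_lt_iff₀ (by positivity)]
    nlinarith [Real.pi_pos]
  have hmθ : (M i j : ℝ) * θ = 2 * Real.pi := by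
    rw [hθ]; field_simp
  have hS (n : ℤ) := Polynomial.Chebyshev.S_two_mul_real_cos θ n
  obtain ⟨k, hk⟩ | ⟨k, hk⟩ := Nat.even_or_odd (M i j)
  · have hzero : (Polynomial.Chebyshev.S ℝ (k - 1)).eval (2 * Real.cos θ) = 0 := by
      refine (mul_eq_zero_iff_right hsin).mp ((hS _).trans ?_)
      rw [show ((k - 1 : ℤ) + 1 : ℝ) * θ = Real.pi by
        push_cast; rw [hk] at hmθ; push_cast at hmθ; linarith, Real.sin_pi]
    rw [show ((M i j : ℤ) - 2) / 2 = k - 1 by omega, show ((M i j : ℤ) - 1) / 2 = k - 1 by omega,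
      hzero]
    simp
  · have hzero : (Polynomial.Chebyshev.S ℝ k).eval (2 * Real.cos θ) +
        (Polynomial.Chebyshev.S ℝ (k - 1)).eval (2 * Real.cos θ) = 0 := by
      refine (mul_eq_zero_iff_right hsin).mp ?_
      rw [add_mul, hS, hS, show ((k : ℤ) + 1 : ℝ) * θ = 2 * Real.pi - k * θ by
        push_cast; rw [hk] at hmθ; push_cast at hmθ; linarith, Real.sin_two_pi_sub]
      push_cast
      rw [sub_add_cancel, neg_add_cancel]
    rw [show ((M i j : ℤ) - 2) / 2 = k - 1 by omega, show ((M i j : ℤ) - 1) / 2 = k by omega,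
      show ((M i j : ℤ) - 3) / 2 = k - 1 by omega, show (M i j : ℤ) / 2 = k by omega, hzero]
    simp

/-- The geometric representation. -/
noncomputable def geomRep : W →* ((B →₀ ℝ) ≃ₗ[ℝ] (B →₀ ℝ)) :=
  cs.lift ⟨geomReflection M, geomReflection_isLiftable⟩

theorem geomRep_simple (i : B) : geomRep cs (cs.simple i) = geomReflection M i :=
  cs.lift_apply_simple _ _

theorem geomRep_ne_one {t : W} (ht : cs.IsReflection t) : geomRep cs t ≠ 1 := by
  obtain ⟨w, i, rfl⟩ := ht
  intro h
  rw [map_mul, map_mul, map_inv, mul_inv_eq_one, mul_eq_left, geomRep_simple] at h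
  have := LinearEquiv.congr_fun h (Finsupp.single i 1)
  rw [geomReflection, Module.reflection_apply_self] at this
  have := DFunLike.congr_fun this i
  simp at this
  norm_num at this

theorem geomRep_apply_apply {J : Set B} {w : W} (hw : w ∈ parabolic cs J) {k : B} (hk : k ∉ J)
    (v : B →₀ ℝ) : geomRep cs w v k = v k := by
  unfold parabolic at hw
  induction hw using Subgroup.closure_induction generalizing v with
  | mem x hx =>
    obtain ⟨i, hi, rfl⟩ := hx
    have : i ≠ k := fun h => hk (h ▸ hi)
    simp [geomRep_simple, geomReflection, Module.reflection_apply, this]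
  | one => simp
  | mul x y _ _ hx hy => rw [map_mul, LinearEquiv.mul_apply, hx, hy]
  | inv x _ hx =>
    rw [← hx, ← LinearEquiv.mul_apply, ← map_mul, mul_inv_cancel, map_one, LinearEquiv.coe_one, id]

theorem not_isReflection_of_mem_of_mem {J K : Set B} (hJK : Disjoint J K) {t : W}
    (hJ : t ∈ parabolic cs J) (hK : t ∈ parabolic cs K) : ¬ cs.IsReflection t := by
  intro ht
  refine geomRep_ne_one cs ht (LinearEquiv.ext fun v => Finsupp.ext fun k => ?_)
  by_cases hk : k ∈ J
  · exact geomRep_apply_apply cs hK (Set.disjoint_left.mp hJK hk) v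
  · exact geomRep_apply_apply cs hJ hk v

theorem length_mul_of_disjoint {J K : Set B} (hJK : Disjoint J K) {p q : W}
    (hp : p ∈ parabolic cs J) (hq : q ∈ parabolic cs K) :
    cs.length (p * q) = cs.length p + cs.length q := by
  obtain ⟨α, hα, rfl, hαJ⟩ := exists_isReduced_of_mem_parabolic cs hp
  obtain ⟨β, hβ, rfl, hβK⟩ := exists_isReduced_of_mem_parabolic cs hq
  clear hp hq
  induction β using List.reverseRecOn with
  | nil => simp
  | append_singleton β i ih =>
    have hβ' : cs.IsReduced β := by simpa using hβ.take β.length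
    have ih := ih hβ' fun j hj => hβK j (by simp [hj])
    have hi : i ∈ K := hβK i (by simp)
    have hlen := hβ.eq
    rw [List.length_append, List.length_singleton] at hlen
    rw [hβ'.eq, hα.eq] at ih
    rw [hlen, hα.eq, cs.wordProd_append, cs.wordProd_singleton, ← mul_assoc]
    by_contra hne
    have hd : cs.IsRightDescent (cs.wordProd (α ++ β)) i := by
      by_contra hnd
      rw [cs.not_isRightDescent_iff, cs.wordProd_append] at hnd
      omega
    obtain ⟨k, hk, hk'⟩ := exists_mul_simple_eq_eraseIdx cs hd
    rw [cs.wordProd_append] at hk'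
    rcases lt_or_ge k α.length with hkα | hkα
    · rw [List.eraseIdx_append_of_lt_length hkα, cs.wordProd_append] at hk'
      have hconj : cs.wordProd β * cs.simple i * (cs.wordProd β)⁻¹ =
          (cs.wordProd α)⁻¹ * cs.wordProd (α.eraseIdx k) := by
        rw [mul_inv_eq_iff_eq_mul, mul_assoc _ _ (cs.wordProd β), ← hk']
        group
      refine not_isReflection_of_mem_of_mem cs hJK (t := cs.wordProd β * cs.simple i *
        (cs.wordProd β)⁻¹) ?_ ?_ ⟨_, i, rfl⟩
      · rw [hconj]
        exact mul_mem (inv_mem (wordProd_mem_parabolic cs hαJ)) (wordProd_mem_parabolic cs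
          fun j hj => hαJ j (List.mem_of_mem_eraseIdx hj))
      · have hβ := wordProd_mem_parabolic cs (J := K) (ω := β) fun j hj => hβK j (by simp [hj])
        exact mul_mem (mul_mem hβ (simple_mem_parabolic cs hi)) (inv_mem hβ)
    · rw [List.eraseIdx_append_of_length_le hkα, cs.wordProd_append, mul_assoc,
        mul_right_inj] at hk'
      have h₁ := cs.length_wordProd_le (β.eraseIdx (k - α.length))
      have h₂ := List.length_eraseIdx_le β (k - α.length)
      rw [← hk', ← cs.wordProd_singleton, ← cs.wordProd_append, hlen] at h₁
      omega

theorem eq_one_of_mem_of_mem {J K : Set B} (hJK : Disjoint J K) {w : W}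
    (hJ : w ∈ parabolic cs J) (hK : w ∈ parabolic cs K) : w = 1 := by
  have := length_mul_of_disjoint cs hJK (inv_mem hJ) hK
  rw [inv_mul_cancel, cs.length_one, cs.length_inv] at this
  exact cs.length_eq_zero_iff.mp (by omega)

/-! ### Parabolic subgroups indexed by `Θ` and `Θ^⊥` -/

theorem disjoint_perp (Θ : Set B) : Disjoint (perp M Θ) Θ :=
  Set.disjoint_left.mpr fun _ h => h.1

theorem commute_of_mem_perp {Θ : Set B} {p q : W} (hp : p ∈ parabolic cs (perp M Θ))
    (hq : q ∈ parabolic cs Θ) : p * q = q * p := by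
  have hle : parabolic cs (perp M Θ) ≤ Subgroup.centralizer (parabolic cs Θ : Set W) := by
    rw [parabolic, parabolic, Subgroup.centralizer_closure, Subgroup.closure_le]
    rintro _ ⟨i, hi, rfl⟩
    rw [SetLike.mem_coe, Subgroup.mem_centralizer_iff]
    rintro _ ⟨j, hj, rfl⟩
    have := cs.simple_mul_simple_pow i j
    rw [hi.2 j hj, pow_two, mul_eq_one_iff_eq_inv, mul_inv_rev, cs.inv_simple, cs.inv_simple]
      at this
    exact this.symm
  exact (Subgroup.mem_centralizer_iff.mp (hle hp) q hq).symm

theorem exists_eq_mul_of_mem_parabolic_union_perp {Θ : Set B} {x : W}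
    (hx : x ∈ parabolic cs (Θ ∪ perp M Θ)) :
    ∃ p ∈ parabolic cs (perp M Θ), ∃ q ∈ parabolic cs Θ, x = p * q := by
  rw [parabolic] at hx
  induction hx using Subgroup.closure_induction with
  | mem x hx =>
    obtain ⟨i, hi | hi, rfl⟩ := hx
    · exact ⟨1, one_mem _, _, simple_mem_parabolic cs hi, (one_mul _).symm⟩
    · exact ⟨_, simple_mem_parabolic cs hi, 1, one_mem _, (mul_one _).symm⟩
  | one => exact ⟨1, one_mem _, 1, one_mem _, (one_mul _).symm⟩
  | mul x y _ _ hx hy =>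
    obtain ⟨p, hp, q, hq, rfl⟩ := hx
    obtain ⟨p', hp', q', hq', rfl⟩ := hy
    refine ⟨p * p', mul_mem hp hp', q * q', mul_mem hq hq', ?_⟩
    rw [mul_assoc, ← mul_assoc q, ← commute_of_mem_perp cs hp' hq]
    simp only [mul_assoc]
  | inv x _ hx =>
    obtain ⟨p, hp, q, hq, rfl⟩ := hx
    refine ⟨p⁻¹, inv_mem hp, q⁻¹, inv_mem hq, ?_⟩
    rw [commute_of_mem_perp cs hp hq, mul_inv_rev]

/-! ### Minimal coset representatives and normal forms -/

theorem eq_of_mem_minRight {J : Set B} {a a' x : W} (ha : a ∈ minRight cs J)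
    (ha' : a' ∈ minRight cs J) (hx : x ∈ parabolic cs J) (h : a' = a * x) : a' = a := by
  have h₁ := ha x hx
  have h₂ := ha' x⁻¹ (inv_mem hx)
  rw [← h] at h₁
  rw [h, mul_inv_cancel_right, ← h, cs.length_inv] at h₂
  rw [h, cs.length_eq_zero_iff.mp (show cs.length x = 0 by omega), mul_one]

/-- Deodhar's lemma: left multiplication by a simple reflection either preserves minimality of a
coset representative or fixes the coset. -/
theorem eq_one_or_of_simple_mul_eq {J : Set B} {a a' y : W} {i : B} (ha : a ∈ minRight cs J)
    (ha' : a' ∈ minRight cs J) (hy : y ∈ parabolic cs J) (h : cs.simple i * a = a' * y) :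
    y = 1 ∨ a' = a ∧ cs.length y = 1 := by
  have h' : cs.simple i * a' = a * y⁻¹ := by
    rw [eq_mul_inv_iff_mul_eq, mul_assoc, ← h, cs.simple_mul_simple_cancel_left]
  have h₁ := ha' y hy
  have h₂ := ha y⁻¹ (inv_mem hy)
  rw [← h] at h₁
  rw [← h', cs.length_inv] at h₂
  have h₃ := cs.length_simple_mul a i
  have h₄ := cs.length_simple_mul a' i
  rcases Nat.eq_zero_or_pos (cs.length y) with h₀ | h₀
  · exact Or.inl (cs.length_eq_zero_iff.mp h₀)
  have hy₁ : cs.length y = 1 := by omega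
  refine Or.inr ⟨?_, hy₁⟩
  obtain ⟨j, rfl⟩ := cs.length_eq_one_iff.mp hy₁
  have ha'_eq : cs.simple i * a * cs.simple j = a' := by
    rw [h, cs.simple_mul_simple_cancel_right]
  have := simple_mul_eq_mul_simple cs (w := a) (i := i) (j := j) (by omega)
    (by rw [ha _ hy, hy₁]) (by rw [ha'_eq]; omega)
  rw [← ha'_eq, this, cs.simple_mul_simple_cancel_right]

theorem simRel_trans {Θ : Set B} {x y z : W × W} (hxy : simRel cs Θ x y)
    (hyz : simRel cs Θ y z) : simRel cs Θ x z := by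
  obtain ⟨u, hu, v, hv, h₁, h₂⟩ := hxy
  obtain ⟨u', hu', v', hv', h₃, h₄⟩ := hyz
  refine ⟨u * u', mul_mem hu hu', u * v' * u⁻¹ * v, mul_mem ?_ hv, ?_, ?_⟩
  · obtain ⟨p, hp, q, hq, rfl⟩ := exists_eq_mul_of_mem_parabolic_union_perp cs hu
    have hqv := mul_mem (mul_mem hq hv') (inv_mem hq)
    rw [show p * q * v' * (p * q)⁻¹ = p * (q * v' * q⁻¹) * p⁻¹ by group,
      commute_of_mem_perp cs hp hqv, mul_inv_cancel_right]
    exact hqv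
  · rw [h₃, h₁, mul_assoc]
  · rw [h₄, h₂]
    group

/-- The normal form II representative of the class of `(a * (p * q), w)`. -/
theorem eq_and_eq_of_simRel {Θ : Set B} {w₂ a₀ p q a b : W}
    (h₂ : w₂ ∈ minLeft cs (Θ ∪ perp M Θ)) (ha₀ : a₀ ∈ minRight cs (Θ ∪ perp M Θ))
    (hp : p ∈ parabolic cs (perp M Θ)) (hq : q ∈ parabolic cs Θ)
    (ha : a ∈ minRight cs (Θ ∪ perp M Θ)) (hb : b ∈ minLeft cs Θ)
    (h : simRel cs Θ (a₀ * (p * q), w₂) (a, b)) : a = a₀ ∧ b = p * w₂ := by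
  obtain ⟨u, hu, v, hv, hau, hbv⟩ := h
  dsimp only at hau hbv
  have hp' := parabolic_mono cs (Set.subset_union_right (s := Θ)) hp
  have hΘ := parabolic_mono cs (Set.subset_union_left (s := Θ) (t := perp M Θ))
  have haa : a = a₀ := eq_of_mem_minRight cs ha₀ ha (mul_mem (mul_mem hp' (hΘ hq)) hu)
    (by rw [hau, mul_assoc a₀])
  refine ⟨haa, ?_⟩
  have hu : u⁻¹ = p * q := by
    rw [haa, mul_assoc, left_eq_mul] at hau
    exact inv_eq_of_mul_eq_one_left hau
  have hqv := mul_mem hq hv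
  have hb₁ : b = p * (q * v) * w₂ := by rw [hbv, hu]; simp only [mul_assoc]
  have hb₂ : (q * v)⁻¹ * b = p * w₂ := by
    rw [hb₁, commute_of_mem_perp cs hp hqv, inv_mul_eq_iff_eq_mul, mul_assoc]
  have hl₁ := hb _ (inv_mem hqv)
  have hl₂ := h₂ _ (mul_mem hp' (hΘ hqv))
  have hl₃ := length_mul_of_disjoint cs (disjoint_perp Θ) hp hqv
  rw [hb₂, h₂ _ hp', cs.length_inv] at hl₁
  rw [← hb₁] at hl₂
  rw [hb₁, cs.length_eq_zero_iff.mp (show cs.length (q * v) = 0 by omega), mul_one]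

/-- behaviour of the extended length `l₋₋` (computed on the normal
form II representative) under left multiplication by a simple reflection `σ_i`. -/
theorem statement15 [Finite B] (Θ : Set B) (w₁ w₂ : W) (i : B)
    (h₁ : w₁ ∈ minRight cs Θ) (h₂ : w₂ ∈ minLeft cs (Θ ∪ perp M Θ))
    (a b a' b' : W)
    (ha : a ∈ minRight cs (Θ ∪ perp M Θ)) (hb : b ∈ minLeft cs Θ)
    (hab : simRel cs Θ (w₁, w₂) (a, b))
    (ha' : a' ∈ minRight cs (Θ ∪ perp M Θ)) (hb' : b' ∈ minLeft cs Θ)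
    (hab' : simRel cs Θ (cs.simple i * w₁, w₂) (a', b')) :
    (((cs.length (cs.simple i * w₁) + 1 = cs.length w₁ ∧
          w₁⁻¹ * cs.simple i * w₁ ∉ parabolic cs (Θ ∪ perp M Θ)) ∨
        (cs.length (cs.simple i * w₁) = cs.length w₁ + 1 ∧
          w₁⁻¹ * cs.simple i * w₁ ∈ parabolic cs (perp M Θ)) →
        -(cs.length a' : ℤ) + cs.length b' = -(cs.length a : ℤ) + cs.length b + 1) ∧
      (w₁⁻¹ * cs.simple i * w₁ ∈ parabolic cs Θ →
        -(cs.length a' : ℤ) + cs.length b' = -(cs.length a : ℤ) + cs.length b) ∧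
      ((cs.length (cs.simple i * w₁) = cs.length w₁ + 1 ∧
          w₁⁻¹ * cs.simple i * w₁ ∉ parabolic cs (Θ ∪ perp M Θ)) ∨
        (cs.length (cs.simple i * w₁) + 1 = cs.length w₁ ∧
          w₁⁻¹ * cs.simple i * w₁ ∈ parabolic cs (perp M Θ)) →
        -(cs.length a' : ℤ) + cs.length b' = -(cs.length a : ℤ) + cs.length b - 1)) ∧
    (-(cs.length a' : ℤ) + cs.length b' = -(cs.length a : ℤ) + cs.length b ↔
      simRel cs Θ (cs.simple i * w₁, w₂) (w₁, w₂)) := by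
  have hΘ := parabolic_mono cs (Set.subset_union_left (s := Θ) (t := perp M Θ))
  have hperp := parabolic_mono cs (Set.subset_union_right (s := Θ) (t := perp M Θ))
  obtain ⟨u, hu, v, -, hau, -⟩ := id hab
  obtain ⟨u', hu', v', -, hau', -⟩ := id hab'
  dsimp only at hau hau'
  obtain ⟨p, hp, hw₁⟩ : ∃ p ∈ parabolic cs (perp M Θ), w₁ = a * p := by
    obtain ⟨p, hp, q, hq, hpq⟩ := exists_eq_mul_of_mem_parabolic_union_perp cs (inv_mem hu)
    have hw₁ : w₁ = a * (p * q) := by rw [hau, ← hpq, mul_inv_cancel_right]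
    have hl₁ := h₁ _ (inv_mem hq)
    have hl₂ := ha _ (mul_mem (hperp hp) (hΘ hq))
    have hl₃ := length_mul_of_disjoint cs (disjoint_perp Θ) hp hq
    rw [hw₁, mul_assoc, mul_inv_cancel_right, ha _ (hperp hp), cs.length_inv] at hl₁
    rw [cs.length_eq_zero_iff.mp (show cs.length q = 0 by omega), mul_one] at hw₁
    exact ⟨p, hp, hw₁⟩
  clear u hu v hau
  obtain ⟨y, hy, hay⟩ : ∃ y ∈ parabolic cs (Θ ∪ perp M Θ), cs.simple i * a = a' * y := by
    refine ⟨u'⁻¹ * p⁻¹, mul_mem (inv_mem hu') (inv_mem (hperp hp)), ?_⟩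
    rw [hau', hw₁]
    group
  clear u' hu' v' hau'
  subst hw₁
  obtain ⟨-, hb_eq⟩ := eq_and_eq_of_simRel cs h₂ ha hp (one_mem _) ha hb (by rwa [mul_one])
  have hlw : cs.length (a * p) = cs.length a + cs.length p := ha _ (hperp hp)
  have hlb : cs.length b = cs.length p + cs.length w₂ := by rw [hb_eq, h₂ _ (hperp hp)]
  have hconj : (a * p)⁻¹ * cs.simple i * (a * p) = p⁻¹ * (a⁻¹ * (cs.simple i * a)) * p := by
    group
  have hr_ne : (a * p)⁻¹ * cs.simple i * (a * p) ≠ 1 := by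
    intro h
    rw [mul_assoc, inv_mul_eq_one] at h
    exact cs.length_simple_mul_ne (a * p) i (by rw [← h])
  have hdisj : (a * p)⁻¹ * cs.simple i * (a * p) ∈ parabolic cs Θ →
      (a * p)⁻¹ * cs.simple i * (a * p) ∉ parabolic cs (perp M Θ) := fun h h' =>
    hr_ne (eq_one_of_mem_of_mem cs (disjoint_perp Θ) h' h)
  have hlen := cs.length_simple_mul (a * p) i
  obtain ⟨p', hp', q', hq', rfl⟩ := exists_eq_mul_of_mem_parabolic_union_perp cs hy
  have hwp : cs.simple i * (a * p) = a' * (p' * p * q') := by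
    rw [← mul_assoc, hay, mul_assoc, mul_assoc p', mul_assoc p',
      commute_of_mem_perp cs hp hq']
  obtain ⟨-, hb'_eq⟩ := eq_and_eq_of_simRel cs h₂ ha' (mul_mem hp' hp) hq' ha' hb'
    (by rwa [← hwp])
  have hlb' : cs.length b' = cs.length (p' * p) + cs.length w₂ := by
    rw [hb'_eq, h₂ _ (hperp (mul_mem hp' hp))]
  have hlw' : cs.length (cs.simple i * (a * p)) = cs.length a' + cs.length (p' * p) +
      cs.length q' := by
    rw [hwp, ha' _ (mul_mem (hperp (mul_mem hp' hp)) (hΘ hq')),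
      length_mul_of_disjoint cs (disjoint_perp Θ) (mul_mem hp' hp) hq', add_assoc]
  have hsim : simRel cs Θ (cs.simple i * (a * p), w₂) (a * p, w₂) →
      cs.length a' = cs.length a ∧ cs.length b' = cs.length b := by
    intro h
    have hab' := simRel_trans cs h hab
    rw [hwp] at hab'
    obtain ⟨h₃, h₄⟩ := eq_and_eq_of_simRel cs h₂ ha' (mul_mem hp' hp) hq' ha hb hab'
    rw [h₃, h₄, hb'_eq]
    exact ⟨rfl, rfl⟩
  rcases eq_one_or_of_simple_mul_eq cs ha ha' hy hay with h_one | ⟨rfl, hlen_one⟩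
  · have hr : (a * p)⁻¹ * cs.simple i * (a * p) ∉ parabolic cs (Θ ∪ perp M Θ) := by
      intro h
      rw [hconj, hay, h_one, mul_one, Subgroup.mul_mem_cancel_right _ (hperp hp),
        Subgroup.mul_mem_cancel_left _ (inv_mem (hperp hp))] at h
      have haa := eq_of_mem_minRight cs ha ha' h (mul_inv_cancel_left a a').symm
      rw [h_one, mul_one, haa] at hay
      exact cs.length_simple_mul_ne a i (by rw [hay])
    have hrΘ := fun h => hr (hΘ h)
    have hrp := fun h => hr (hperp h)
    have hlen_one := length_mul_of_disjoint cs (disjoint_perp Θ) hp' hq'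
    rw [h_one, cs.length_one] at hlen_one
    have hp'_one : p' = 1 := cs.length_eq_zero_iff.mp (by omega)
    rw [hp'_one, one_mul] at hlb' hlw'
    refine ⟨⟨?_, ?_, ?_⟩, ?_⟩
    · rintro (⟨h, -⟩ | ⟨-, h⟩)
      · omega
      · exact absurd h hrp
    · exact fun h => absurd h hrΘ
    · rintro (⟨h, -⟩ | ⟨-, h⟩)
      · omega
      · exact absurd h hrp
    · constructor
      · intro h
        omega
      · intro h
        have := hsim h
        omega
  rw [length_mul_of_disjoint cs (disjoint_perp Θ) hp' hq'] at hlen_one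
  rw [hay, inv_mul_cancel_left] at hconj
  rcases Nat.eq_zero_or_pos (cs.length p') with hzero | hpos
  · obtain rfl := cs.length_eq_zero_iff.mp hzero
    rw [one_mul, mul_assoc p⁻¹, ← commute_of_mem_perp cs hp hq', inv_mul_cancel_left] at hconj
    rw [one_mul] at hlb'
    rw [← hconj] at hq'
    refine ⟨⟨?_, ?_, ?_⟩, ?_⟩
    · rintro (⟨-, h⟩ | ⟨-, h⟩)
      · exact absurd (hΘ hq') h
      · exact absurd h (hdisj hq')
    · intro _
      omega
    · rintro (⟨-, h⟩ | ⟨-, h⟩)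
      · exact absurd (hΘ hq') h
      · exact absurd h (hdisj hq')
    · refine iff_of_true (by omega) ⟨_, hΘ hq', _, hq', ?_, ?_⟩
      · simp [mul_assoc]
      · rw [inv_mul_cancel, one_mul]
  · obtain rfl := cs.length_eq_zero_iff.mp (show cs.length q' = 0 by omega)
    have hr : (a' * p)⁻¹ * cs.simple i * (a' * p) ∈ parabolic cs (perp M Θ) := by
      rw [hconj, mul_one]
      exact mul_mem (mul_mem (inv_mem hp) hp') hp
    rw [cs.length_one] at hlw'
    refine ⟨⟨?_, ?_, ?_⟩, ?_⟩
    · rintro (⟨-, h⟩ | ⟨h, -⟩)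
      · exact absurd (hperp hr) h
      · omega
    · exact fun h => absurd hr (hdisj h)
    · rintro (⟨-, h⟩ | ⟨h, -⟩)
      · exact absurd (hperp hr) h
      · omega
    · constructor
      · intro h
        omega
      · intro h
        have := hsim h
        omega

end Paper
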